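/- Let ν ∈ ℝ, let û, U : ℝ × ℝ → ℝ be twice continuously differentiable, let a, u_d : ℝ × ℝ → ℝ be continuous, and let r : ℝ → ℝ be continuously differentiable. Suppose that for all t ≥ 0 and x ∈ [0,1], U satisfies the regulator equation ∂ₜU = ν·∂ₓₓU − U·∂ₓU + a·(û + U) − (û·∂ₓU + U·∂ₓû) + u_d, together with the Neumann boundary conditions ν·∂ₓU(t,0) = F₀(t) and ν·∂ₓU(t,1) = F₁(t), where F₀(t) = û(t,0)·U(t,0) + (1/2)·U(t,0)² and F₁(t) = û(t,1)·U(t,1) + (1/2)·U(t,1)² + r'(t) − ∫₀¹ [a(t,x)·(û(t,x) + U(t,x)) + u_d(t,x)] dx. If in addition ∫₀¹ U(0,x) dx = r(0), then ∫₀¹ U(t,x) dx = r(t) for all t ≥ 0. -/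

import Mathlib

/-- Partial derivative in the first (time) variable. -/
noncomputable def pt (w : ℝ × ℝ → ℝ) (t x : ℝ) : ℝ := deriv (fun s => w (s, x)) t

/-- First partial derivative in the second (space) variable. -/
noncomputable def px (w : ℝ × ℝ → ℝ) (t x : ℝ) : ℝ := deriv (fun y => w (t, y)) x

/-- Second partial derivative in the second (space) variable. -/
noncomputable def pxx (w : ℝ × ℝ → ℝ) (t x : ℝ) : ℝ := deriv (fun y => px w t y) x

theorem hasDerivAt_fst_slice {w : ℝ × ℝ → ℝ} (hw : Differentiable ℝ w) (t x : ℝ) :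
    HasDerivAt (fun s => w (s, x)) (fderiv ℝ w (t, x) (1, 0)) t :=
  (hw (t, x)).hasFDerivAt.comp_hasDerivAt t ((hasDerivAt_id t).prodMk (hasDerivAt_const t x))

theorem hasDerivAt_snd_slice {w : ℝ × ℝ → ℝ} (hw : Differentiable ℝ w) (t x : ℝ) :
    HasDerivAt (fun y => w (t, y)) (fderiv ℝ w (t, x) (0, 1)) x :=
  (hw (t, x)).hasFDerivAt.comp_hasDerivAt x ((hasDerivAt_const x t).prodMk (hasDerivAt_id x))

theorem px_eq_fderiv {w : ℝ × ℝ → ℝ} (hw : Differentiable ℝ w) (t x : ℝ) :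
    px w t x = fderiv ℝ w (t, x) (0, 1) :=
  (hasDerivAt_snd_slice hw t x).deriv

theorem contDiff_px {w : ℝ × ℝ → ℝ} {m n : WithTop ℕ∞} (hw : ContDiff ℝ n w)
    (hmn : m + 1 ≤ n) : ContDiff ℝ m (fun p : ℝ × ℝ => px w p.1 p.2) := by
  have hd : Differentiable ℝ w := (hw.of_le (le_add_self.trans hmn)).differentiable one_ne_zero
  simp only [px_eq_fderiv hd]
  exact (hw.fderiv_right hmn).clm_apply contDiff_const

/-- Differentiation under the integral sign for a continuously differentiable integrand. -/
theorem hasDerivAt_intervalIntegral_slice {w : ℝ × ℝ → ℝ} (hw : ContDiff ℝ 1 w) (a b t : ℝ) :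
    HasDerivAt (fun s => ∫ x in a..b, w (s, x)) (∫ x in a..b, pt w t x) t := by
  have hd : Differentiable ℝ w := hw.differentiable one_ne_zero
  have hpt : ∀ s x, pt w s x = fderiv ℝ w (s, x) (1, 0) := fun s x =>
    (hasDerivAt_fst_slice hd s x).deriv
  have hc : Continuous fun p : ℝ × ℝ => pt w p.1 p.2 := by
    simp only [hpt]
    exact (hw.continuous_fderiv one_ne_zero).clm_apply continuous_const
  obtain ⟨C, hC⟩ := ((isCompact_closedBall t 1).prod
    (isCompact_uIcc (a := a) (b := b))).exists_bound_of_continuousOn hc.continuousOn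
  refine (intervalIntegral.hasDerivAt_integral_of_dominated_loc_of_deriv_le
    (F := fun s x => w (s, x)) (F' := fun s x => pt w s x) (bound := fun _ => C)
    (Metric.closedBall_mem_nhds t one_pos) ?_ ?_ ?_ ?_ ?_ ?_).2
  · exact .of_forall fun s => (hw.continuous.comp (by fun_prop)).aestronglyMeasurable
  · exact (hw.continuous.comp (by fun_prop : Continuous fun x : ℝ => (t, x))).intervalIntegrable _ _
  · exact (hc.comp (by fun_prop : Continuous fun x : ℝ => (t, x))).aestronglyMeasurable
  · exact .of_forall fun x hx s hs => hC (s, x) ⟨hs, Set.uIoc_subset_uIcc hx⟩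
  · exact intervalIntegrable_const
  · exact .of_forall fun x _ s _ => by simpa only [hpt] using hasDerivAt_fst_slice hd s x

/-- regulation identity (regulator2): under the feedforward
controllers of Theorem 1, the spatial average of `U` reproduces the reference. -/
theorem stmt_11 (ν : ℝ) (uh U a ud : ℝ × ℝ → ℝ) (r : ℝ → ℝ)
    (huh : ContDiff ℝ 2 uh) (hU : ContDiff ℝ 2 U)
    (ha : Continuous a) (hud : Continuous ud) (hr : ContDiff ℝ 1 r)
    (heq : ∀ t ≥ (0:ℝ), ∀ x ∈ Set.Icc (0:ℝ) 1,
      pt U t x = ν * pxx U t x - U (t, x) * px U t x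
        + a (t, x) * (uh (t, x) + U (t, x))
        - (uh (t, x) * px U t x + U (t, x) * px uh t x) + ud (t, x))
    (hbc0 : ∀ t ≥ (0:ℝ),
      ν * px U t 0 = uh (t, 0) * U (t, 0) + (1/2) * (U (t, 0)) ^ 2)
    (hbc1 : ∀ t ≥ (0:ℝ),
      ν * px U t 1 = uh (t, 1) * U (t, 1) + (1/2) * (U (t, 1)) ^ 2 + deriv r t
        - ∫ x in (0:ℝ)..1,
            (a (t, x) * (uh (t, x) + U (t, x)) + ud (t, x)))
    (hic : (∫ x in (0:ℝ)..1, U (0, x)) = r 0) :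
    ∀ t ≥ (0:ℝ), (∫ x in (0:ℝ)..1, U (t, x)) = r t := by
  have hdU : Differentiable ℝ U := hU.differentiable two_ne_zero
  have hduh : Differentiable ℝ uh := huh.differentiable two_ne_zero
  have hpxU : ContDiff ℝ 1 (fun p : ℝ × ℝ => px U p.1 p.2) :=
    contDiff_px hU (by norm_num [one_add_one_eq_two])
  have hpxuh : ContDiff ℝ 1 (fun p : ℝ × ℝ => px uh p.1 p.2) :=
    contDiff_px huh (by norm_num [one_add_one_eq_two])
  have hpxxU : Continuous (fun p : ℝ × ℝ => pxx U p.1 p.2) :=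
    (contDiff_px (m := 0) hpxU (by norm_num)).continuous
  have dx : ∀ {w : ℝ × ℝ → ℝ}, Differentiable ℝ w → ∀ t x,
      HasDerivAt (fun y => w (t, y)) (px w t x) x := fun hw t x =>
    (hasDerivAt_snd_slice hw t x).differentiableAt.hasDerivAt
  have flux : ∀ t ≥ (0:ℝ), ∫ x in (0:ℝ)..1, pt U t x = deriv r t := by
    intro t ht
    have slice : Continuous fun x : ℝ => (t, x) := by fun_prop
    have cU := hU.continuous.comp slice
    have cuh := huh.continuous.comp slice
    have cpU := hpxU.continuous.comp slice
    have cpuh := hpxuh.continuous.comp slice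
    have cppU := hpxxU.comp slice
    have ca := ha.comp slice
    have cud := hud.comp slice
    simp only [Function.comp_def] at cU cuh cpU cpuh cppU ca cud
    have hG : ∀ x ∈ Set.uIcc (0:ℝ) 1, HasDerivAt
        (fun y => ν * px U t y - (1/2) * U (t, y) ^ 2 - uh (t, y) * U (t, y))
        (ν * pxx U t x - U (t, x) * px U t x
          - (uh (t, x) * px U t x + U (t, x) * px uh t x)) x := by
      intro x _
      have h := (((dx (hpxU.differentiable one_ne_zero) t x).const_mul ν).sub
        (((dx hdU t x).pow 2).const_mul (1/2))).sub ((dx hduh t x).mul (dx hdU t x))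
      refine h.congr_deriv ?_
      simp only [pxx, px]
      ring
    have ftc := intervalIntegral.integral_eq_sub_of_hasDerivAt hG
      (Continuous.intervalIntegrable (by fun_prop) _ _)
    have split : ∫ x in (0:ℝ)..1, pt U t x =
        (∫ x in (0:ℝ)..1, (ν * pxx U t x - U (t, x) * px U t x
          - (uh (t, x) * px U t x + U (t, x) * px uh t x)))
        + ∫ x in (0:ℝ)..1, (a (t, x) * (uh (t, x) + U (t, x)) + ud (t, x)) := by
      rw [← intervalIntegral.integral_add (Continuous.intervalIntegrable (by fun_prop) _ _)
        (Continuous.intervalIntegrable (by fun_prop) _ _)]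
      refine intervalIntegral.integral_congr fun x hx => ?_
      rw [Set.uIcc_of_le zero_le_one] at hx
      simp only [heq t ht x hx]
      ring
    linarith [hbc0 t ht, hbc1 t ht]
  have hm := fun t => hasDerivAt_intervalIntegral_slice (hU.of_le one_le_two) 0 1 t
  intro t ht
  refine eq_of_has_deriv_right_eq (a := 0) (b := t) (f' := deriv r)
    (fun s hs => (flux s hs.1 ▸ hm s).hasDerivWithinAt)
    (fun s _ => (hr.differentiable one_ne_zero s).hasDerivAt.hasDerivWithinAt)
    (fun s _ => (hm s).continuousAt.continuousWithinAt) hr.continuous.continuousOn hic t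
    (Set.right_mem_Icc.2 ht)
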